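/- arXiv:1811.12575 — 3 statements merged into one kernel-verified Lean document; each statement's English description precedes it below -/
import Mathlib

section
/- Let p : ℕ → ℝ be nonincreasing with p k ≥ 0 for all k and summable. For every m ≥ 1 and every finite set T ⊆ ℕ × ℕ with |T| ≤ m, one has ∑_{(j,k) ∈ T} p j · p k ≤ (∑_{k=0}^{m−1} p k)². In words: the sum of any m entries of the product array (p j · p k)_{j,k} is at most the square of the sum of the m largest entries of p. -/
/-- The sum of an antitone real sequence over a finite set of indices is at most the sum of
its first terms, as many as the set has elements. -/
theorem Antitone.sum_le_sum_range_card {p : ℕ → ℝ} (hp : Antitone p) (s : Finset ℕ) :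
    ∑ k ∈ s, p k ≤ ∑ k ∈ Finset.range s.card, p k := by
  induction s using Finset.induction_on_max with
  | empty => simp
  | insert a s hlt ih =>
    have ha : a ∉ s := fun h => lt_irrefl a (hlt a h)
    have hcard : s.card ≤ a := by
      simpa using Finset.card_le_card (fun x hx => Finset.mem_range.2 (hlt x hx))
    rw [Finset.sum_insert ha, Finset.card_insert_of_notMem ha, Finset.sum_range_succ, add_comm]
    exact add_le_add ih (hp hcard)

/-- For a nonnegative, nonincreasing, summable sequence `p`, every
`m ≥ 1`, and every finite set `T ⊆ ℕ × ℕ` with `|T| ≤ m`, the sum of the product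
array over `T` is at most the square of the sum of the `m` largest entries of `p`. -/
theorem product_array_finset_sum_le_sq
    (p : ℕ → ℝ)
    (hnonneg : ∀ k, 0 ≤ p k)
    (hmono : ∀ k, p (k + 1) ≤ p k)
    (hsum : Summable p)
    (m : ℕ) (hm : 1 ≤ m)
    (T : Finset (ℕ × ℕ)) (hT : T.card ≤ m) :
    ∑ jk ∈ T, p jk.1 * p jk.2 ≤ (∑ k ∈ Finset.range m, p k) ^ 2 := by
  have hle (s : Finset ℕ) (hs : s.card ≤ m) : ∑ k ∈ s, p k ≤ ∑ k ∈ Finset.range m, p k :=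
    ((antitone_nat_of_succ_le hmono).sum_le_sum_range_card s).trans <|
      Finset.sum_le_sum_of_subset_of_nonneg (Finset.range_mono hs) fun k _ _ => hnonneg k
  calc ∑ jk ∈ T, p jk.1 * p jk.2
      ≤ ∑ jk ∈ T.image Prod.fst ×ˢ T.image Prod.snd, p jk.1 * p jk.2 :=
        Finset.sum_le_sum_of_subset_of_nonneg Finset.subset_product
          fun jk _ _ => mul_nonneg (hnonneg _) (hnonneg _)
    _ = (∑ j ∈ T.image Prod.fst, p j) * ∑ k ∈ T.image Prod.snd, p k := by
        rw [Finset.sum_mul_sum, Finset.sum_product]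
    _ ≤ (∑ k ∈ Finset.range m, p k) ^ 2 := by
        rw [sq]
        exact mul_le_mul (hle _ (Finset.card_image_le.trans hT))
          (hle _ (Finset.card_image_le.trans hT)) (Finset.sum_nonneg fun k _ => hnonneg k)
          (Finset.sum_nonneg fun k _ => hnonneg k)
end

section
/- Let p : ℕ → ℝ be a nonincreasing probability sequence with p 0 ≤ 2/3, let g : ℕ → ℝ satisfy g k ≥ 0 for all k and ∑' k, g k = 1 (no monotonicity assumed), and let π : ℕ × ℕ × ℕ → ℕ be any bijection. Then the total variation distance between the rearranged distribution (i,j,k) ↦ p (π (i,j,k)) and the product distribution (i,j,k) ↦ p i · p j · g k is at least 2/9; that is, (1/2) · ∑'_{(i,j,k)} |p (π (i,j,k)) − p i · p j · g k| ≥ 2/9. -/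
/-- The `n` leading terms of a nonnegative antitone sequence have the largest sum among all
sets of at most `n` terms. -/
theorem Antitone.sum_le_sum_range_of_card_le {p : ℕ → ℝ} (hp : Antitone p) (hpos : ∀ k, 0 ≤ p k)
    {S : Finset ℕ} {n : ℕ} (hS : S.card ≤ n) :
    ∑ k ∈ S, p k ≤ ∑ k ∈ Finset.range n, p k := by
  have hcard : (S \ Finset.range n).card ≤ (Finset.range n \ S).card := by
    rw [Finset.card_sdiff_le_card_sdiff_iff]
    simpa using hS
  have h₁ : ∑ k ∈ S \ Finset.range n, p k ≤ (S \ Finset.range n).card • p n := by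
    refine Finset.sum_le_card_nsmul _ _ _ fun k hk => hp ?_
    simpa using (Finset.mem_sdiff.1 hk).2
  have h₂ : (Finset.range n \ S).card • p n ≤ ∑ k ∈ Finset.range n \ S, p k := by
    refine Finset.card_nsmul_le_sum _ _ _ fun k hk => hp ?_
    simpa using (Finset.mem_range.1 (Finset.mem_sdiff.1 hk).1).le
  have h₃ := nsmul_le_nsmul_left (hpos n) hcard
  rw [← Finset.sum_inter_add_sum_sdiff S (Finset.range n),
    ← Finset.sum_inter_add_sum_sdiff (Finset.range n) S, Finset.inter_comm]
  linarith

/-- The excess of one distribution over another on a finite event is at most their total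
variation distance. -/
theorem sum_sub_le_half_tsum_abs_sub {ι : Type*} {r q : ι → ℝ} {a : ℝ} (hr : HasSum r a)
    (hq : HasSum q a) (A : Finset ι) :
    ∑ x ∈ A, (r x - q x) ≤ (1 / 2) * ∑' x, |r x - q x| := by
  have hd : HasSum (fun x => r x - q x) 0 := by simpa using hr.sub hq
  have hadd := hd.summable.abs.hasSum.add hd
  have h := sum_le_hasSum A
    (fun x _ => by linarith [neg_abs_le (r x - q x)]) hadd
  have h' : ∑ x ∈ A, 2 * (r x - q x) ≤ ∑ x ∈ A, (|r x - q x| + (r x - q x)) :=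
    Finset.sum_le_sum fun x _ => by linarith [le_abs_self (r x - q x)]
  rw [← Finset.mul_sum] at h'
  linarith

/-- A nonincreasing probability sequence whose first term is at most `2/3` has a partial sum in
`[1/3, 2/3]`. -/
theorem Antitone.exists_sum_range_mem_Icc {p : ℕ → ℝ} (hp : Antitone p) (hsum : HasSum p 1)
    (h0 : p 0 ≤ 2 / 3) :
    ∃ n, ∑ k ∈ Finset.range n, p k ∈ Set.Icc (1 / 3 : ℝ) (2 / 3) := by
  have hex : ∃ n, 1 / 3 ≤ ∑ k ∈ Finset.range n, p k :=
    ((hsum.tendsto_sum_nat.eventually (lt_mem_nhds (by norm_num : (1 / 3 : ℝ) < 1))).exists).imp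
      fun _ h => le_of_lt h
  classical
  obtain ⟨n, hn, hmin⟩ : ∃ n, 1 / 3 ≤ ∑ k ∈ Finset.range n, p k ∧
      ∀ m < n, ¬ 1 / 3 ≤ ∑ k ∈ Finset.range m, p k :=
    ⟨Nat.find hex, Nat.find_spec hex, fun _ h => Nat.find_min hex h⟩
  refine ⟨n, hn, ?_⟩
  rcases n with _ | _ | n
  · norm_num at hn
  · simpa using h0
  · have h₁ := not_le.1 (hmin (n + 1) (by omega))
    have h₂ := not_le.1 (hmin 1 (by omega))
    have h₃ := hp (Nat.zero_le (n + 1))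
    rw [Finset.sum_range_succ]
    rw [Finset.sum_range_one] at h₂
    linarith

/-- A finite set has product mass at most the product of the masses of its first two
projections, when the third factor is a probability distribution. -/
theorem sum_mul_mul_le_sum_image_mul_sum_image {α β γ : Type*} [DecidableEq α] [DecidableEq β]
    {p : α → ℝ} {q : β → ℝ} {g : γ → ℝ} (hp : ∀ i, 0 ≤ p i) (hq : ∀ j, 0 ≤ q j)
    (hg : ∀ k, 0 ≤ g k) (hgsum : HasSum g 1) (A : Finset (α × β × γ)) :
    ∑ x ∈ A, p x.1 * q x.2.1 * g x.2.2 ≤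
      (∑ i ∈ A.image (fun x => x.1), p i) * ∑ j ∈ A.image (fun x => x.2.1), q j := by
  classical
  have hsub : A ⊆ A.image (fun x => x.1) ×ˢ A.image (fun x => x.2.1) ×ˢ
      A.image (fun x => x.2.2) := fun x hx => by
    simp only [Finset.mem_product]
    exact ⟨Finset.mem_image_of_mem _ hx, Finset.mem_image_of_mem (fun x => x.2.1) hx,
      Finset.mem_image_of_mem (fun x => x.2.2) hx⟩
  have hpos : ∀ x : α × β × γ, 0 ≤ p x.1 * q x.2.1 * g x.2.2 := fun x =>
    mul_nonneg (mul_nonneg (hp _) (hq _)) (hg _)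
  refine (Finset.sum_le_sum_of_subset_of_nonneg hsub fun x _ _ => hpos x).trans ?_
  have hg1 : ∑ k ∈ A.image (fun x => x.2.2), g k ≤ 1 :=
    sum_le_hasSum _ (fun k _ => hg k) hgsum
  simp only [Finset.sum_product, mul_assoc, ← Finset.mul_sum, ← Finset.sum_mul]
  exact mul_le_mul_of_nonneg_left
    (mul_le_of_le_one_right (Finset.sum_nonneg fun j _ => hq j) hg1)
    (Finset.sum_nonneg fun i _ => hp i)

/-- For a nonincreasing probability sequence `p` with `p 0 ≤ 2/3`, a
nonnegative sequence `g` summing to 1, and any bijection `π : ℕ × ℕ × ℕ → ℕ`, the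
total variation distance between the rearranged distribution `x ↦ p (π x)` and the
product distribution `(i,j,k) ↦ p i * p j * g k` is at least `2/9`. -/
theorem self_embezzlement_channel_tv_lower_bound
    (p : ℕ → ℝ)
    (hnonneg : ∀ k, 0 ≤ p (k + 1))
    (hmono : ∀ k, p (k + 1) ≤ p k)
    (hsum : Summable p)
    (htot : ∑' k, p k = 1)
    (h0 : p 0 ≤ 2 / 3)
    (g : ℕ → ℝ) (hg : ∀ k, 0 ≤ g k) (hgtot : ∑' k, g k = 1)
    (π : ℕ × ℕ × ℕ → ℕ) (hπ : Function.Bijective π) :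
    (1 / 2) * ∑' x : ℕ × ℕ × ℕ, |p (π x) - p x.1 * p x.2.1 * g x.2.2| ≥ 2 / 9 := by
  have hp : Antitone p := antitone_nat_of_succ_le hmono
  have hpos : ∀ k, 0 ≤ p k := fun k => (hnonneg k).trans (hmono k)
  have hp1 : HasSum p 1 := htot ▸ hsum.hasSum
  have hg1 : HasSum g 1 := by
    have hgs : Summable g := by
      by_contra h
      simp [tsum_eq_zero_of_not_summable h] at hgtot
    exact hgtot ▸ hgs.hasSum
  have hr : HasSum (fun x => p (π x)) 1 := (Equiv.ofBijective π hπ).hasSum_iff.2 hp1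
  have hq : HasSum (fun x : ℕ × ℕ × ℕ => p x.1 * p x.2.1 * g x.2.2) 1 := by
    have hpg : HasSum (fun y : ℕ × ℕ => p y.1 * g y.2) 1 := by
      simpa using hp1.mul hg1 (hp1.summable.mul_of_nonneg hg1.summable hpos hg)
    simpa [mul_assoc] using hp1.mul hpg (hp1.summable.mul_of_nonneg hpg.summable hpos
      fun y => mul_nonneg (hpos _) (hg _))
  obtain ⟨n, hn₁, hn₂⟩ := hp.exists_sum_range_mem_Icc hp1 h0
  let e := Equiv.ofBijective π hπ
  let A : Finset (ℕ × ℕ × ℕ) := (Finset.range n).map e.symm.toEmbedding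
  have hA : A.card = n := by simp [A]
  have hrA : ∑ x ∈ A, p (π x) = ∑ k ∈ Finset.range n, p k := by
    rw [Finset.sum_map]
    exact Finset.sum_congr rfl fun k _ => congrArg p (e.apply_symm_apply k)
  have hqA := (sum_mul_mul_le_sum_image_mul_sum_image hpos hpos hg hg1 A).trans
    (mul_le_mul
      (hp.sum_le_sum_range_of_card_le hpos (Finset.card_image_le.trans hA.le))
      (hp.sum_le_sum_range_of_card_le hpos (Finset.card_image_le.trans hA.le))
      (Finset.sum_nonneg fun j _ => hpos j) (Finset.sum_nonneg fun i _ => hpos i))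
  have htv := sum_sub_le_half_tsum_abs_sub hr hq A
  rw [Finset.sum_sub_distrib, hrA] at htv
  nlinarith [mul_nonneg (sub_nonneg.2 hn₁) (sub_nonneg.2 hn₂)]
end

section
/- Let p : ℕ → ℝ be a nonincreasing probability sequence, let g : ℕ → ℝ satisfy g k ≥ 0 for all k and ∑' k, g k = 1, let π : ℕ × ℕ × ℕ → ℕ be any bijection, and let m ≥ 1. Set μ = ∑_{k=0}^{m−1} p k. Then (1/2) · ∑'_{(i,j,k)} |p (π (i,j,k)) − p i · p j · g k| ≥ μ · (1 − μ). -/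
theorem Antitone.sum_le_sum_range_of_card_le_s10 {p : ℕ → ℝ} (hp : Antitone p) (h0 : ∀ k, 0 ≤ p k)
    {A : Finset ℕ} {m : ℕ} (hA : A.card ≤ m) : ∑ k ∈ A, p k ≤ ∑ k ∈ Finset.range m, p k := by
  have hout : ∑ k ∈ A \ Finset.range m, p k ≤ (A \ Finset.range m).card • p m :=
    Finset.sum_le_card_nsmul _ _ _ fun k hk => hp (by simpa using (Finset.mem_sdiff.1 hk).2)
  have hin : (Finset.range m \ A).card • p m ≤ ∑ k ∈ Finset.range m \ A, p k :=
    Finset.card_nsmul_le_sum _ _ _ fun k hk => hp (Finset.mem_range.1 (Finset.mem_sdiff.1 hk).1).le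
  have hcard : (A \ Finset.range m).card ≤ (Finset.range m \ A).card :=
    Finset.card_sdiff_le_card_sdiff_iff.2 (by simpa using hA)
  have hmid := nsmul_le_nsmul_left (h0 m) hcard
  have h1 := Finset.sum_inter_add_sum_sdiff A (Finset.range m) p
  have h2 := Finset.sum_inter_add_sum_sdiff (Finset.range m) A p
  rw [Finset.inter_comm] at h2
  linarith

theorem two_mul_sum_le_tsum_abs {ι : Type*} {d : ι → ℝ} (hd : HasSum d 0) (T : Finset ι) :
    2 * ∑ x ∈ T, d x ≤ ∑' x, |d x| := by
  have hind : HasSum ((T : Set ι).indicator d) (∑ x ∈ T, d x) := by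
    rw [← Finset.sum_indicator_subset d (Finset.Subset.refl T)]
    exact hasSum_sum_of_ne_finset_zero fun x hx => by simp [hx]
  have h := (hind.mul_left 2).sub hd
  rw [sub_zero] at h
  refine hasSum_le (fun x => ?_) h hd.summable.abs.hasSum
  by_cases hx : x ∈ (T : Set ι)
  · rw [Set.indicator_of_mem hx]
    linarith [le_abs_self (d x)]
  · rw [Set.indicator_of_notMem hx]
    linarith [neg_le_abs (d x)]

theorem sum_mul_mul_le_of_card_le {p g : ℕ → ℝ} (hp : Antitone p) (h0 : ∀ k, 0 ≤ p k)
    (hg : ∀ k, 0 ≤ g k) (hgs : HasSum g 1) {T : Finset (ℕ × ℕ × ℕ)} {m : ℕ} (hT : T.card ≤ m) :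
    ∑ x ∈ T, p x.1 * p x.2.1 * g x.2.2 ≤
      (∑ k ∈ Finset.range m, p k) * ∑ k ∈ Finset.range m, p k := by
  classical
  set A := T.image fun x => x.1
  set B := T.image fun x => x.2.1
  set C := T.image fun x => x.2.2
  have hA := hp.sum_le_sum_range_of_card_le_s10 h0 (Finset.card_image_le.trans hT : A.card ≤ m)
  have hB := hp.sum_le_sum_range_of_card_le_s10 h0 (Finset.card_image_le.trans hT : B.card ≤ m)
  have hC : ∑ k ∈ C, g k ≤ 1 := sum_le_hasSum C (fun k _ => hg k) hgs
  have hsub : T ⊆ A ×ˢ B ×ˢ C := fun x hx => by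
    simp only [Finset.mem_product]
    exact ⟨Finset.mem_image_of_mem _ hx, Finset.mem_image_of_mem _ hx,
      Finset.mem_image_of_mem _ hx⟩
  have hA0 : 0 ≤ ∑ k ∈ A, p k := Finset.sum_nonneg fun k _ => h0 k
  have hB0 : 0 ≤ ∑ k ∈ B, p k := Finset.sum_nonneg fun k _ => h0 k
  calc ∑ x ∈ T, p x.1 * p x.2.1 * g x.2.2
      ≤ ∑ x ∈ A ×ˢ B ×ˢ C, p x.1 * p x.2.1 * g x.2.2 :=
        Finset.sum_le_sum_of_subset_of_nonneg hsub fun x _ _ =>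
          mul_nonneg (mul_nonneg (h0 _) (h0 _)) (hg _)
    _ = (∑ k ∈ A, p k) * (∑ k ∈ B, p k) * ∑ k ∈ C, g k := by
        simp only [Finset.sum_product, mul_assoc, ← Finset.mul_sum, ← Finset.sum_mul]
    _ ≤ (∑ k ∈ A, p k) * ∑ k ∈ B, p k := mul_le_of_le_one_right (mul_nonneg hA0 hB0) hC
    _ ≤ _ := mul_le_mul hA hB hB0 (hA0.trans hA)

/-- For a nonincreasing probability sequence `p`, a nonnegative sequence
`g` summing to 1, any bijection `π : ℕ × ℕ × ℕ → ℕ`, and any `m ≥ 1`, writing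
`μ = ∑_{k<m} p k`, the total variation distance between the rearranged distribution
and the product distribution `(i,j,k) ↦ p i * p j * g k` is at least `μ * (1 - μ)`. -/
theorem self_embezzlement_channel_tv_lower_bound_mu
    (p : ℕ → ℝ)
    (hnonneg : ∀ k, 0 ≤ p (k + 1))
    (hmono : ∀ k, p (k + 1) ≤ p k)
    (hsum : Summable p)
    (htot : ∑' k, p k = 1)
    (g : ℕ → ℝ) (hg : ∀ k, 0 ≤ g k) (hgtot : ∑' k, g k = 1)
    (π : ℕ × ℕ × ℕ → ℕ) (hπ : Function.Bijective π)
    (m : ℕ) (hm : 1 ≤ m) :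
    (1 / 2) * ∑' x : ℕ × ℕ × ℕ, |p (π x) - p x.1 * p x.2.1 * g x.2.2| ≥
      (∑ k ∈ Finset.range m, p k) * (1 - ∑ k ∈ Finset.range m, p k) := by
  have hp : Antitone p := antitone_nat_of_succ_le hmono
  have h0 : ∀ k, 0 ≤ p k := fun k => (hnonneg k).trans (hmono k)
  have hps : HasSum p 1 := htot ▸ hsum.hasSum
  have hgsum : Summable g := by
    by_contra h
    rw [tsum_eq_zero_of_not_summable h] at hgtot
    exact zero_ne_one hgtot
  have hgs : HasSum g 1 := hgtot ▸ hgsum.hasSum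
  let e : ℕ × ℕ × ℕ ≃ ℕ := Equiv.ofBijective π hπ
  have hleft : HasSum (fun x => p (π x)) 1 := e.hasSum_iff.2 hps
  have hright : HasSum (fun x : ℕ × ℕ × ℕ => p x.1 * p x.2.1 * g x.2.2) 1 := by
    have hpg : Summable fun y : ℕ × ℕ => p y.1 * g y.2 := hsum.mul_of_nonneg hgsum h0 hg
    have h := hps.mul (hps.mul hgs hpg)
      (hsum.mul_of_nonneg hpg h0 fun y => mul_nonneg (h0 _) (hg _))
    simpa [mul_assoc] using h
  have hd := hleft.sub hright
  rw [sub_self] at hd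
  let T : Finset (ℕ × ℕ × ℕ) := (Finset.range m).map e.symm.toEmbedding
  have htv := two_mul_sum_le_tsum_abs hd T
  have hTp : ∑ x ∈ T, p (π x) = ∑ k ∈ Finset.range m, p k := by
    rw [Finset.sum_map]
    exact Finset.sum_congr rfl fun k _ => congrArg p (e.apply_symm_apply k)
  have hTq := sum_mul_mul_le_of_card_le hp h0 hg hgs (T := T) (m := m) (by simp [T])
  rw [Finset.sum_sub_distrib, hTp] at htv
  linarith
end
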